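/- Let τ be the adding machine automorphism of the binary rooted tree {0,1}^* and consider the action of the infinite cyclic group ⟨τ⟩ ≅ ℤ on {0,1}^*. Two left-infinite binary sequences …x₂x₁ and …y₂y₁ are asymptotically equivalent with respect to this action if and only if ∑_{n≥1} x_n 2^{−n} ≡ ∑_{n≥1} y_n 2^{−n} (mod 1); equivalently, the sequences are equal, or one can be obtained from the other by replacing a tail of the form …110v by …001v (or …11 by …00) and vice versa. -/

import Mathlib

/-- The adding machine: `τ(0w) = 1w`, `τ(1w) = 0·τ(w)` (`false = 0`, `true = 1`). -/
def tau : List Bool → List Bool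
  | [] => []
  | false :: w => true :: w
  | true :: w => false :: tau w

/-- The inverse of the adding machine. -/
def tauInv : List Bool → List Bool
  | [] => []
  | true :: w => false :: w
  | false :: w => true :: tauInv w

lemma tauInv_tau : ∀ w : List Bool, tauInv (tau w) = w := by
  intro w
  induction w with
  | nil => rfl
  | cons a t ih => cases a <;> simp [tau, tauInv, ih]

lemma tau_tauInv : ∀ w : List Bool, tau (tauInv w) = w := by
  intro w
  induction w with
  | nil => rfl
  | cons a t ih => cases a <;> simp [tau, tauInv, ih]

/-- The adding machine as a permutation of the binary tree `{0,1}^*`. -/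
def tauEquiv : Equiv.Perm (List Bool) :=
  ⟨tau, tauInv, tauInv_tau, tau_tauInv⟩

/-- The word `x_k x_{k-1} … x_1` (leftmost letter first) associated to a
left-infinite binary sequence `… x_2 x_1`, encoded by `x : ℕ → Bool` with
`x (i - 1) = x_i`. -/
def wordOf (x : ℕ → Bool) : ℕ → List Bool
  | 0 => []
  | k + 1 => x k :: wordOf x k

lemma length_tau (w : List Bool) : (tau w).length = w.length := by
  induction w with
  | nil => rfl
  | cons a t ih => cases a <;> simp [tau, ih]

/-- The integer whose binary digits, least significant first, are the letters of the word. -/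
def binValue : List Bool → ℤ
  | [] => 0
  | a :: w => (if a then 1 else 0) + 2 * binValue w

lemma pow_dvd_binValue_tau (w : List Bool) :
    (2 : ℤ) ^ w.length ∣ binValue (tau w) - binValue w - 1 := by
  induction w with
  | nil => simp
  | cons a t ih =>
    cases a
    · simp [tau, binValue]
    · obtain ⟨c, hc⟩ := ih
      refine ⟨c, ?_⟩
      simp only [tau, binValue, List.length_cons, pow_succ, Bool.false_eq_true, if_true, if_false]
      linear_combination 2 * hc

lemma length_tauEquiv_zpow (m : ℤ) (w : List Bool) :
    ((tauEquiv ^ m) w).length = w.length := by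
  induction m generalizing w with
  | zero => simp
  | succ i ih => rw [zpow_add_one, Equiv.Perm.mul_apply, ih]; exact length_tau w
  | pred i ih =>
    rw [zpow_sub_one, Equiv.Perm.mul_apply, ih, ← length_tau]
    exact congrArg List.length (tauEquiv.apply_symm_apply w)

/-- The power `τ ^ m` acts on words of length `k` as addition of `m` modulo `2 ^ k`. -/
lemma pow_dvd_binValue_tauEquiv_zpow (m : ℤ) (w : List Bool) :
    (2 : ℤ) ^ w.length ∣ binValue ((tauEquiv ^ m) w) - binValue w - m := by
  induction m with
  | zero => simp
  | succ i ih =>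
    have h := pow_dvd_binValue_tau ((tauEquiv ^ (i : ℤ)) w)
    rw [length_tauEquiv_zpow] at h
    rw [add_comm (i : ℤ), zpow_add, zpow_one, Equiv.Perm.mul_apply]
    refine (dvd_add h ih).trans (dvd_of_eq ?_)
    change _ = binValue (tau _) - _ - _
    ring
  | pred i ih =>
    have h := pow_dvd_binValue_tau ((tauEquiv ^ (-(i : ℤ) - 1)) w)
    rw [length_tauEquiv_zpow] at h
    have e : tau ((tauEquiv ^ (-(i : ℤ) - 1)) w) = (tauEquiv ^ (-(i : ℤ))) w := by
      change tauEquiv _ = _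
      rw [← Equiv.Perm.mul_apply, ← zpow_one_add]
      congr 2
      ring
    rw [e] at h
    refine (dvd_sub ih h).trans (dvd_of_eq ?_)
    ring

lemma length_wordOf (x : ℕ → Bool) (k : ℕ) : (wordOf x k).length = k := by
  induction k with
  | zero => rfl
  | succ k ih => simp [wordOf, ih]

lemma binValue_wordOf_div (x : ℕ → Bool) (k : ℕ) :
    (binValue (wordOf x k) : ℝ) / 2 ^ k =
      ∑ i ∈ Finset.range k, (if x i then (1 : ℝ) else 0) / 2 ^ (i + 1) := by
  induction k with
  | zero => simp [wordOf, binValue]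
  | succ k ih =>
    rw [Finset.sum_range_succ, ← ih]
    simp only [wordOf, binValue]
    split_ifs <;> push_cast <;> rw [pow_succ] <;> field_simp <;> ring

/-- The real number with binary expansion `0.x₁x₂…`. -/
noncomputable def binSum (x : ℕ → Bool) : ℝ :=
  ∑' k : ℕ, (if x k then (1 : ℝ) else 0) / 2 ^ (k + 1)

lemma hasSum_two_inv_pow_succ : HasSum (fun k : ℕ => (1 : ℝ) / 2 ^ (k + 1)) 1 := by
  convert hasSum_geometric_two' (1 : ℝ) using 2 with k
  rw [pow_succ]
  field_simp

lemma summable_binSum (x : ℕ → Bool) :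
    Summable fun k : ℕ => (if x k then (1 : ℝ) else 0) / 2 ^ (k + 1) := by
  refine hasSum_two_inv_pow_succ.summable.of_nonneg_of_le (fun k => ?_) fun k => ?_
  · split_ifs <;> positivity
  · gcongr
    split_ifs <;> norm_num

lemma binSum_nonneg (x : ℕ → Bool) : 0 ≤ binSum x :=
  tsum_nonneg fun k => by split_ifs <;> positivity

lemma binSum_le_one (x : ℕ → Bool) : binSum x ≤ 1 := by
  rw [← hasSum_two_inv_pow_succ.tsum_eq]
  refine (summable_binSum x).tsum_le_tsum (fun k => ?_) hasSum_two_inv_pow_succ.summable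
  gcongr
  split_ifs <;> norm_num

lemma binSum_eq_shift (x : ℕ → Bool) :
    binSum x = ((if x 0 then 1 else 0) + binSum fun k => x (k + 1)) / 2 := by
  rw [binSum, (summable_binSum x).tsum_eq_zero_add, binSum, add_div, ← tsum_div_const]
  congr 1
  · norm_num
  · refine tsum_congr fun k => ?_
    rw [pow_succ _ (k + 1), div_div]

lemma eq_true_of_binSum_eq_one {x : ℕ → Bool} (h : binSum x = 1) (k : ℕ) : x k = true := by
  have hs := binSum_eq_shift x
  have hle := binSum_le_one fun k => x (k + 1)
  have h0 : x 0 = true := by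
    by_contra hx
    rw [if_neg hx] at hs
    linarith
  rw [if_pos h0] at hs
  match k with
  | 0 => exact h0
  | k + 1 => exact eq_true_of_binSum_eq_one (x := fun k => x (k + 1)) (by linarith) k

lemma eq_false_of_binSum_eq_zero {x : ℕ → Bool} (h : binSum x = 0) (k : ℕ) : x k = false := by
  have h0 : (if x k then (1 : ℝ) else 0) / 2 ^ (k + 1) = 0 := by
    have hsum := (summable_binSum x).hasSum
    rw [← binSum, h] at hsum
    refine congrFun ((hasSum_zero_iff_of_nonneg fun i => ?_).1 hsum) k
    split_ifs <;> positivity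
  cases hx : x k
  · rfl
  · simp [hx] at h0

lemma binSum_shift_eq {x y : ℕ → Bool} (h : binSum x = binSum y) {n : ℕ}
    (hxy : ∀ k < n, x k = y k) : binSum (fun k => x (k + n)) = binSum fun k => y (k + n) := by
  induction n with
  | zero => exact h
  | succ n ih =>
    have hn := ih fun k hk => hxy k (hk.trans n.lt_succ_self)
    rw [binSum_eq_shift, binSum_eq_shift fun k => y (k + n)] at hn
    simp only [zero_add, hxy n n.lt_succ_self, add_right_comm _ 1 n] at hn
    simp only [← add_assoc]
    linarith

lemma eq_of_binSum_sub_eq_one {x y : ℕ → Bool} (h : binSum x - binSum y = 1) (k : ℕ) :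
    x k = true ∧ y k = false := by
  have := binSum_le_one x
  have := binSum_nonneg y
  exact ⟨eq_true_of_binSum_eq_one (by linarith) k, eq_false_of_binSum_eq_zero (by linarith) k⟩

lemma tail_of_binSum_eq {x y : ℕ → Bool} (h : binSum x = binSum y) {n : ℕ}
    (hxy : ∀ k < n, x k = y k) (hx : x n = false) (hy : y n = true) (k : ℕ) (hk : n < k) :
    x k = true ∧ y k = false := by
  have hn := binSum_shift_eq h hxy
  rw [binSum_eq_shift, binSum_eq_shift fun k => y (k + n)] at hn
  simp only [zero_add, hx, hy, Bool.false_eq_true, if_true, if_false] at hn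
  obtain ⟨j, rfl⟩ := Nat.exists_eq_add_of_lt hk
  have := eq_of_binSum_sub_eq_one (x := fun k => x (k + 1 + n)) (y := fun k => y (k + 1 + n))
    (by linarith) j
  rwa [show j + 1 + n = n + j + 1 by ring] at this

lemma wordOf_congr {x y : ℕ → Bool} {k : ℕ} (h : ∀ i < k, x i = y i) : wordOf x k = wordOf y k := by
  induction k with
  | zero => rfl
  | succ k ih =>
    rw [wordOf, wordOf, h k k.lt_succ_self, ih fun i hi => h i (hi.trans k.lt_succ_self)]

lemma tau_wordOf_of_forall {x y : ℕ → Bool} (h : ∀ k, x k = true ∧ y k = false) (k : ℕ) :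
    tau (wordOf x k) = wordOf y k := by
  induction k with
  | zero => rfl
  | succ k ih => simp [wordOf, h k, tau, ih]

lemma tau_wordOf_of_tail {x y : ℕ → Bool} {n : ℕ} (hxy : ∀ k < n, x k = y k) (hx : x n = false)
    (hy : y n = true) (h : ∀ k, n < k → x k = true ∧ y k = false) {k : ℕ} (hk : n < k) :
    tau (wordOf x k) = wordOf y k := by
  induction k, hk using Nat.le_induction with
  | base => simp [wordOf, hx, hy, tau, wordOf_congr hxy]
  | succ k hk ih => simp [wordOf, h k hk, tau, ih]

/-- Asymptotic equivalence of left-infinite sequences under the action of `⟨τ⟩`. -/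
def AsympEquiv (x y : ℕ → Bool) : Prop :=
  ∃ m : ℕ → ℤ, (Set.range fun k => tauEquiv ^ m k).Finite ∧
    ∀ k : ℕ, (tauEquiv ^ m k) (wordOf x k) = wordOf y k

lemma AsympEquiv.symm {x y : ℕ → Bool} (h : AsympEquiv x y) : AsympEquiv y x := by
  obtain ⟨m, hm, h⟩ := h
  refine ⟨fun k => -m k, ?_, fun k => ?_⟩
  · convert hm.image fun g => g⁻¹
    rw [← Set.range_comp]
    simp [Function.comp_def]
  · rw [← h k, ← Equiv.Perm.mul_apply, ← zpow_add]
    simp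

lemma asympEquiv_of_forall {x y : ℕ → Bool} (h : ∀ k, x k = true ∧ y k = false) :
    AsympEquiv x y :=
  ⟨fun _ => 1, Set.finite_range_const, fun k => tau_wordOf_of_forall h k⟩

lemma asympEquiv_of_tail {x y : ℕ → Bool} {n : ℕ} (hxy : ∀ k < n, x k = y k)
    (hx : x n = false) (hy : y n = true) (h : ∀ k, n < k → x k = true ∧ y k = false) :
    AsympEquiv x y := by
  refine ⟨fun k => if n < k then 1 else 0,
    (Set.toFinite {tauEquiv, 1}).subset ?_, fun k => ?_⟩
  · rintro _ ⟨k, rfl⟩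
    dsimp only
    split_ifs <;> simp
  · dsimp only
    split_ifs with hk
    · exact tau_wordOf_of_tail hxy hx hy h hk
    · exact wordOf_congr fun i hi => hxy i (by omega)

open Filter Topology in
lemma AsympEquiv.exists_binSum_sub_eq {x y : ℕ → Bool} (h : AsympEquiv x y) :
    ∃ z : ℤ, binSum x - binSum y = z := by
  obtain ⟨m, hm, h⟩ := h
  -- choose exponents depending only on the group element, so that they are bounded
  have hg : ∀ g ∈ Set.range fun k => tauEquiv ^ m k, ∃ a : ℤ, tauEquiv ^ a = g := by
    rintro _ ⟨k, rfl⟩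
    exact ⟨m k, rfl⟩
  choose! e he using hg
  have hfin : (Set.range fun k => e (tauEquiv ^ m k)).Finite := by
    have := hm.image e
    rwa [← Set.range_comp] at this
  have hdvd : ∀ k, (2 : ℤ) ^ k ∣
      binValue (wordOf y k) - binValue (wordOf x k) - e (tauEquiv ^ m k) := fun k => by
    have := pow_dvd_binValue_tauEquiv_zpow (e (tauEquiv ^ m k)) (wordOf x k)
    rwa [he _ ⟨k, rfl⟩, h k, length_wordOf] at this
  choose q hq using hdvd
  obtain ⟨B, hB⟩ : ∃ B : ℝ, ∀ k, |(e (tauEquiv ^ m k) : ℝ)| ≤ B := by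
    obtain ⟨B, hB⟩ := (hfin.image fun a : ℤ => |(a : ℝ)|).bddAbove
    exact ⟨B, fun k => hB ⟨_, ⟨k, rfl⟩, rfl⟩⟩
  have hlim : Tendsto (fun k => (e (tauEquiv ^ m k) : ℝ) / 2 ^ k) atTop (𝓝 0) := by
    have hz : Tendsto (fun k : ℕ => B * (1 / 2 : ℝ) ^ k) atTop (𝓝 0) := by
      simpa using (tendsto_pow_atTop_nhds_zero_of_lt_one (r := (1 / 2 : ℝ))
        (by norm_num) (by norm_num)).const_mul B
    refine squeeze_zero_norm (fun k => ?_) hz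
    rw [Real.norm_eq_abs, abs_div, abs_of_pos (by positivity : (0 : ℝ) < 2 ^ k), one_div,
      inv_pow, div_eq_mul_inv]
    gcongr
    exact hB k
  have hsum (x : ℕ → Bool) :
      Tendsto (fun k => (binValue (wordOf x k) : ℝ) / 2 ^ k) atTop (𝓝 (binSum x)) := by
    simp only [binValue_wordOf_div]
    exact (summable_binSum x).hasSum.tendsto_sum_nat
  have hq_lim : Tendsto (fun k => ((-q k : ℤ) : ℝ)) atTop (𝓝 (binSum x - binSum y)) := by
    have := ((hsum x).sub (hsum y)).add hlim
    rw [add_zero] at this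
    refine this.congr fun k => ?_
    have hk : (binValue (wordOf y k) : ℝ) - binValue (wordOf x k) - e (tauEquiv ^ m k) =
        2 ^ k * q k := mod_cast hq k
    push_cast
    field_simp
    linarith
  obtain ⟨z, hz⟩ := Int.isClosedEmbedding_coe_real.isClosed_range.mem_of_tendsto hq_lim
    (Eventually.of_forall fun k => ⟨-q k, rfl⟩)
  exact ⟨z, hz.symm⟩

/-- `x` and `y` are equal or are the two binary expansions of a point of `ℝ / ℤ`. -/
def SameExpansion (x y : ℕ → Bool) : Prop :=
  x = y ∨
    (∀ k : ℕ, x k = true ∧ y k = false) ∨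
    (∀ k : ℕ, x k = false ∧ y k = true) ∨
    (∃ n : ℕ, (∀ k : ℕ, k < n → x k = y k) ∧ x n = false ∧ y n = true ∧
      ∀ k : ℕ, n < k → x k = true ∧ y k = false) ∨
    (∃ n : ℕ, (∀ k : ℕ, k < n → x k = y k) ∧ x n = true ∧ y n = false ∧
      ∀ k : ℕ, n < k → x k = false ∧ y k = true)

lemma SameExpansion.asympEquiv {x y : ℕ → Bool} (h : SameExpansion x y) : AsympEquiv x y := by
  rcases h with rfl | h | h | ⟨n, hxy, hx, hy, h⟩ | ⟨n, hxy, hx, hy, h⟩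
  · exact ⟨fun _ => 0, Set.finite_range_const, fun k => rfl⟩
  · exact asympEquiv_of_forall h
  · exact (asympEquiv_of_forall fun k => (h k).symm).symm
  · exact asympEquiv_of_tail hxy hx hy h
  · exact (asympEquiv_of_tail (fun k hk => (hxy k hk).symm) hy hx fun k hk => (h k hk).symm).symm

lemma sameExpansion_of_binSum_eq {x y : ℕ → Bool} (h : binSum x = binSum y) :
    SameExpansion x y := by
  by_cases hne : x = y
  · exact Or.inl hne
  have hex : ∃ n, x n ≠ y n := Function.ne_iff.1 hne
  obtain ⟨n, hn, hmin⟩ : ∃ n, x n ≠ y n ∧ ∀ k < n, x k = y k :=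
    ⟨Nat.find hex, Nat.find_spec hex, fun k hk => not_not.1 (Nat.find_min hex hk)⟩
  have hmin' : ∀ k < n, y k = x k := fun k hk => (hmin k hk).symm
  cases hx : x n <;> cases hy : y n
  · exact absurd (hx.trans hy.symm) hn
  · exact Or.inr (Or.inr (Or.inr (Or.inl ⟨n, hmin, hx, hy, tail_of_binSum_eq h hmin hx hy⟩)))
  · exact Or.inr (Or.inr (Or.inr (Or.inr ⟨n, hmin, hx, hy, fun k hk =>
      (tail_of_binSum_eq h.symm hmin' hy hx k hk).symm⟩)))
  · exact absurd (hx.trans hy.symm) hn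

lemma sameExpansion_of_binSum_sub_eq {x y : ℕ → Bool} {z : ℤ} (h : binSum x - binSum y = z) :
    SameExpansion x y := by
  have hx0 := binSum_nonneg x
  have hy0 := binSum_nonneg y
  have hx1 := binSum_le_one x
  have hy1 := binSum_le_one y
  have hz1 : z ≤ 1 := by
    have : (z : ℝ) ≤ 1 := by linarith
    exact_mod_cast this
  have hz0 : -1 ≤ z := by
    have : (-1 : ℝ) ≤ z := by linarith
    exact_mod_cast this
  interval_cases z
  · exact Or.inr (Or.inr (Or.inl fun k =>
      (eq_of_binSum_sub_eq_one (by push_cast at h; linarith) k).symm))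
  · exact sameExpansion_of_binSum_eq (by push_cast at h; linarith)
  · exact Or.inr (Or.inl (eq_of_binSum_sub_eq_one (by push_cast at h; linarith)))

/-- For the action of the infinite cyclic group `⟨τ⟩ ≅ ℤ` generated by the adding
machine, two left-infinite binary sequences `…x₂x₁` and `…y₂y₁` are
asymptotically equivalent iff `∑ x_n 2^{-n} ≡ ∑ y_n 2^{-n} (mod 1)`;
equivalently, iff the sequences are equal, or one is obtained from the other by
replacing a tail `…110v` by `…001v` (or `…11` by `…00`). -/
theorem statement10 :
    ∀ x y : ℕ → Bool,
      ((∃ m : ℕ → ℤ, (Set.range fun k => tauEquiv ^ m k).Finite ∧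
          ∀ k : ℕ, (tauEquiv ^ m k) (wordOf x k) = wordOf y k) ↔
        (∃ z : ℤ,
          (∑' k : ℕ, (if x k then (1 : ℝ) else 0) / 2 ^ (k + 1)) -
            (∑' k : ℕ, (if y k then (1 : ℝ) else 0) / 2 ^ (k + 1)) = z)) ∧
      ((∃ m : ℕ → ℤ, (Set.range fun k => tauEquiv ^ m k).Finite ∧
          ∀ k : ℕ, (tauEquiv ^ m k) (wordOf x k) = wordOf y k) ↔
        (x = y ∨
          (∀ k : ℕ, x k = true ∧ y k = false) ∨
          (∀ k : ℕ, x k = false ∧ y k = true) ∨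
          (∃ n : ℕ, (∀ k : ℕ, k < n → x k = y k) ∧ x n = false ∧ y n = true ∧
            ∀ k : ℕ, n < k → x k = true ∧ y k = false) ∨
          (∃ n : ℕ, (∀ k : ℕ, k < n → x k = y k) ∧ x n = true ∧ y n = false ∧
            ∀ k : ℕ, n < k → x k = false ∧ y k = true))) := by
  exact fun x y =>
    ⟨⟨AsympEquiv.exists_binSum_sub_eq, fun ⟨_, h⟩ =>
      (sameExpansion_of_binSum_sub_eq h).asympEquiv⟩,
    ⟨fun h => let ⟨_, hz⟩ := AsympEquiv.exists_binSum_sub_eq h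
      sameExpansion_of_binSum_sub_eq hz, SameExpansion.asympEquiv⟩⟩
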